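/- Let σ₂ = [[1,0],[0,−1]], σ₅ = [[0,1],[1,0]], I = I₂, and let H(σ₂) = {h ∈ GL(2,ℝ) : ᵀh⁻¹ σ₂ h⁻¹ = λσ₂ for some λ ∈ ℝ, λ ≠ 0}. For α ∈ ℝ let 𝔥_α = span{I + ασ₅} ⊆ M₂(ℝ) and let 𝔥_∞ = span{σ₅}. Then: (a) for α₁, α₂ ∈ ℝ, there exists g ∈ H(σ₂) with g·𝔥_{α₁}·g⁻¹ = 𝔥_{α₂} if and only if α₁ = α₂ or α₁ = −α₂; (b) for no α ∈ ℝ and no g ∈ H(σ₂) does g·𝔥_∞·g⁻¹ = 𝔥_α hold. -/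

import Mathlib

open Matrix

noncomputable section

/-- The action `h†[σ] = ᵀh⁻¹ σ h⁻¹`. -/
def dag (h σ : Matrix (Fin 2) (Fin 2) ℝ) : Matrix (Fin 2) (Fin 2) ℝ :=
  h⁻¹ᵀ * σ * h⁻¹

/-- `σ₂ = [[1,0],[0,-1]]`. -/
def sigma2 : Matrix (Fin 2) (Fin 2) ℝ := !![1, 0; 0, -1]

/-- `σ₅ = [[0,1],[1,0]]`. -/
def sigma5 : Matrix (Fin 2) (Fin 2) ℝ := !![0, 1; 1, 0]

/-- `H(σ₂) = {h ∈ GL(2,ℝ) : h†[σ₂] = λσ₂ for some λ ≠ 0}`. -/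
def Hsigma2 : Set (Matrix (Fin 2) (Fin 2) ℝ) :=
  {h | IsUnit h ∧ ∃ l : ℝ, l ≠ 0 ∧ dag h sigma2 = l • sigma2}

/-- Conjugation of a set of matrices: `g·S·g⁻¹`. -/
def conjSet (g : Matrix (Fin 2) (Fin 2) ℝ) (S : Set (Matrix (Fin 2) (Fin 2) ℝ)) :
    Set (Matrix (Fin 2) (Fin 2) ℝ) :=
  (fun X => g * X * g⁻¹) '' S

/-- `𝔥_α = span{I + ασ₅}`. -/
def halg (α : ℝ) : Set (Matrix (Fin 2) (Fin 2) ℝ) :=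
  (Submodule.span ℝ {(1 : Matrix (Fin 2) (Fin 2) ℝ) + α • sigma5} :
    Submodule ℝ (Matrix (Fin 2) (Fin 2) ℝ))

/-- `𝔥_∞ = span{σ₅}`. -/
def hinf : Set (Matrix (Fin 2) (Fin 2) ℝ) :=
  (Submodule.span ℝ {sigma5} : Submodule ℝ (Matrix (Fin 2) (Fin 2) ℝ))

theorem aux_trace (g X : Matrix (Fin 2) (Fin 2) ℝ) (hg : IsUnit g) :
    (g * X * g⁻¹).trace = X.trace ∧ (g * X * g⁻¹).det = X.det := by
  have hd : IsUnit g.det := (Matrix.isUnit_iff_isUnit_det g).1 hg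
  constructor
  · rw [Matrix.trace_mul_comm, ← Matrix.mul_assoc, Matrix.nonsing_inv_mul g hd, Matrix.one_mul]
  · have h1 : g.det * (g⁻¹).det = 1 := by
      rw [← Matrix.det_mul, Matrix.mul_nonsing_inv g hd, Matrix.det_one]
    rw [Matrix.det_mul, Matrix.det_mul]
    linear_combination X.det * h1

theorem aux_sigma2_inv : sigma2⁻¹ = sigma2 := by
  apply Matrix.inv_eq_left_inv
  ext i j; fin_cases i <;> fin_cases j <;> simp [sigma2, Matrix.mul_apply]

theorem aux_conj (a : ℝ) : sigma2 * (1 + a • sigma5) * sigma2 = 1 + (-a) • sigma5 := by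
  ext i j; fin_cases i <;> fin_cases j <;>
    simp [sigma2, sigma5, Matrix.one_fin_two]

theorem aux_sq : sigma2 * sigma2 = 1 := by
  ext i j; fin_cases i <;> fin_cases j <;> simp [sigma2, Matrix.mul_apply]

theorem stmt8 :
    -- (a)
    (∀ α₁ α₂ : ℝ,
      (∃ g ∈ Hsigma2, conjSet g (halg α₁) = halg α₂) ↔ (α₁ = α₂ ∨ α₁ = -α₂)) ∧
    -- (b)
    (∀ α : ℝ, ∀ g ∈ Hsigma2, conjSet g hinf ≠ halg α) := by
  refine ⟨fun a b => ⟨?_, ?_⟩, ?_⟩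
  · rintro ⟨g, hg, h⟩
    have hm : g * (1 + a • sigma5) * g⁻¹ ∈ halg b := by
      rw [← h]
      exact ⟨_, Submodule.mem_span_singleton_self _, rfl⟩
    obtain ⟨c, hc⟩ := Submodule.mem_span_singleton.1 hm
    obtain ⟨ht, hd⟩ := aux_trace g (1 + a • sigma5) hg.1
    rw [← hc] at ht hd
    simp [Matrix.trace_fin_two, Matrix.det_fin_two, sigma5] at ht hd
    have hc1 : c = 1 := by linarith
    subst hc1
    apply sq_eq_sq_iff_eq_or_eq_neg.1
    linarith
  · rintro (rfl | h)
    · refine ⟨1, ⟨isUnit_one, 1, one_ne_zero, ?_⟩, ?_⟩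
      · simp [dag]
      · simp [conjSet]
    · obtain rfl : b = -a := by linarith
      refine ⟨sigma2, ⟨IsUnit.of_mul_eq_one _ aux_sq, 1, one_ne_zero, ?_⟩, ?_⟩
      · rw [dag, aux_sigma2_inv, Matrix.mul_assoc, aux_sq]
        simp [sigma2]
        ext i j; fin_cases i <;> fin_cases j <;> simp
      · ext X
        simp only [conjSet, halg, aux_sigma2_inv, Set.mem_image, SetLike.mem_coe,
          Submodule.mem_span_singleton]
        constructor
        · rintro ⟨_, ⟨c, rfl⟩, rfl⟩
          exact ⟨c, by rw [Matrix.mul_smul, Matrix.smul_mul, aux_conj]⟩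
        · rintro ⟨c, rfl⟩
          exact ⟨_, ⟨c, rfl⟩, by rw [Matrix.mul_smul, Matrix.smul_mul, aux_conj]⟩
  · intro a g hg h
    have hm : g * sigma5 * g⁻¹ ∈ halg a := by
      rw [← h]
      exact ⟨_, Submodule.mem_span_singleton_self _, rfl⟩
    obtain ⟨c, hc⟩ := Submodule.mem_span_singleton.1 hm
    obtain ⟨ht, hd⟩ := aux_trace g sigma5 hg.1
    rw [← hc] at ht hd
    simp only [Matrix.trace_fin_two, Matrix.det_fin_two, sigma5] at ht hd
    simp at ht hd
    have hc1 : c = 0 := by linarith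
    subst hc1
    norm_num at hd
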